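/- Let m be a positive integer such that 2m/5 is an integer, and let M be a uniformly random subset of [2m] of size m. For any disjoint index sets I⁺, I⁻ ⊆ [2m] with |I⁺| = |I⁻| = 2m/5, with probability at least 1 − 2^{−(2m/5 − 1)} there exist r⁺ ∈ I⁺ and r⁻ ∈ I⁻ such that r⁺ ∈ M and r⁻ ∈ Mᶜ (the complement of M in [2m]). -/

import Mathlib

open Finset

theorem choose_halving (m n : ℕ) (hm : 0 < m) (hn : n + 1 ≤ 2 * m) :
    2 * n.choose m ≤ (n + 1).choose m := by
  obtain ⟨j, rfl⟩ : ∃ j, m = j + 1 := ⟨m - 1, by omega⟩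
  rw [Nat.choose_succ_succ']
  have h := Nat.choose_succ_right_eq n j
  have h2 : n.choose j * (n - j) ≤ n.choose j * (j + 1) :=
    Nat.mul_le_mul_left _ (by omega)
  have h3 : n.choose (j + 1) ≤ n.choose j :=
    Nat.le_of_mul_le_mul_right (h.trans_le h2) (by omega)
  omega

theorem choose_pow (m : ℕ) (hm : 0 < m) (k : ℕ) (hk : k ≤ 2 * m) :
    2 ^ k * (2 * m - k).choose m ≤ (2 * m).choose m := by
  induction k with
  | zero => simp
  | succ k ih =>
    have h1 := choose_halving m (2 * m - (k + 1)) hm (by omega)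
    have h2 : 2 * m - (k + 1) + 1 = 2 * m - k := by omega
    rw [h2] at h1
    calc 2 ^ (k + 1) * (2 * m - (k + 1)).choose m
        = 2 ^ k * (2 * (2 * m - (k + 1)).choose m) := by ring
      _ ≤ 2 ^ k * (2 * m - k).choose m := Nat.mul_le_mul_left _ h1
      _ ≤ _ := ih (by omega)

/-- Lemma `filter_convertion`.
Let `m` be a positive integer with `2m/5` an integer, and let `M` be a uniformly random subset
of `[2m]` of size `m`.  For any disjoint index sets `I⁺, I⁻ ⊆ [2m]` with
`|I⁺| = |I⁻| = 2m/5`, with probability at least `1 − 2^{−(2m/5 − 1)}` there exist `r⁺ ∈ I⁺`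
and `r⁻ ∈ I⁻` with `r⁺ ∈ M` and `r⁻ ∈ Mᶜ`.

Uniform randomness over the `m`-element subsets is expressed by counting: the number of
`m`-element subsets `M` for which the conclusion holds is at least
`(1 − 2^{−(2m/5 − 1)})` times the total number of `m`-element subsets. -/
theorem stmt_4 (m : ℕ) (hm : 0 < m) (h5 : 5 ∣ 2 * m)
    (Iplus Iminus : Finset (Fin (2 * m)))
    (hdisj : Disjoint Iplus Iminus)
    (hIp : Iplus.card = 2 * m / 5) (hIm : Iminus.card = 2 * m / 5) :
    (1 - (2 : ℝ) ^ (-(((2 * m / 5 : ℕ) : ℝ) - 1))) *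
        ((Finset.univ : Finset (Fin (2 * m))).powersetCard m).card ≤
      (((Finset.univ : Finset (Fin (2 * m))).powersetCard m).filter
          (fun M => ∃ rp ∈ Iplus, ∃ rm ∈ Iminus, rp ∈ M ∧ rm ∉ M)).card := by
  classical
  set k := 2 * m / 5 with hk
  have hk2 : k ≤ 2 * m := Nat.div_le_self _ _
  set P := (Finset.univ : Finset (Fin (2 * m))).powersetCard m with hP
  have hPc : P.card = (2 * m).choose m := by simp [hP]
  have hB1 : (Iplusᶜ.powersetCard m).card = (2 * m - k).choose m := by
    rw [card_powersetCard, card_compl, hIp, Fintype.card_fin]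
  have hB2 : ((Iminusᶜ.powersetCard m).image compl).card ≤ (2 * m - k).choose m := by
    refine card_image_le.trans ?_
    rw [card_powersetCard, card_compl, hIm, Fintype.card_fin]
  have hsub : P.filter (fun M => ¬ ∃ rp ∈ Iplus, ∃ rm ∈ Iminus, rp ∈ M ∧ rm ∉ M) ⊆
      Iplusᶜ.powersetCard m ∪ (Iminusᶜ.powersetCard m).image compl := by
    intro M hM
    rw [mem_filter, hP, mem_powersetCard] at hM
    obtain ⟨⟨-, hc⟩, hM⟩ := hM
    rw [mem_union]
    by_cases h : ∃ rp ∈ Iplus, rp ∈ M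
    · right
      obtain ⟨rp, h1, h2⟩ := h
      rw [mem_image]
      refine ⟨Mᶜ, ?_, compl_compl M⟩
      rw [mem_powersetCard]
      refine ⟨?_, ?_⟩
      · intro x hx
        rw [mem_compl] at hx ⊢
        exact fun hxI => hM ⟨rp, h1, x, hxI, h2, hx⟩
      · rw [card_compl, hc, Fintype.card_fin]; omega
    · left
      rw [mem_powersetCard]
      refine ⟨?_, hc⟩
      intro x hx
      rw [mem_compl]
      exact fun hxI => h ⟨x, hxI, hx⟩
  have hbad := (card_le_card hsub).trans (card_union_le _ _)
  have hsum := card_filter_add_card_filter_not (s := P)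
    (fun M => ∃ rp ∈ Iplus, ∃ rm ∈ Iminus, rp ∈ M ∧ rm ∉ M)
  have hch := choose_pow m hm k hk2
  have hpow : (2 : ℝ) ^ (-((k : ℝ) - 1)) = 2 / 2 ^ k := by
    rw [neg_sub, Real.rpow_sub two_pos, Real.rpow_one, Real.rpow_natCast]
  rw [hpow]
  have hle : P.card ≤ (P.filter (fun M => ∃ rp ∈ Iplus, ∃ rm ∈ Iminus, rp ∈ M ∧ rm ∉ M)).card
      + 2 * (2 * m - k).choose m := by omega
  rw [← hPc] at hch
  have hle' : (P.card : ℝ) ≤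
      (P.filter (fun M => ∃ rp ∈ Iplus, ∃ rm ∈ Iminus, rp ∈ M ∧ rm ∉ M)).card
      + 2 * ((2 * m - k).choose m : ℝ) := by exact_mod_cast hle
  have hch' : (2 : ℝ) ^ k * ((2 * m - k).choose m : ℝ) ≤ P.card := by exact_mod_cast hch
  have h3 : ((2 * m - k).choose m : ℝ) ≤ P.card / 2 ^ k := by
    rw [le_div_iff₀ (by positivity)]; linarith
  have h4 : (1 - 2 / (2 : ℝ) ^ k) * P.card = P.card - 2 * (P.card / 2 ^ k) := by ring
  rw [h4]
  linarith
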